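/- Let μ, ν be compactly supported, atomless Borel probability measures on ℝ, λ_C := W∞(μ,ν), γ̄ an ∞-cyclically monotone optimal plan and γ any optimal plan. If there exists x̄ ∈ M_γ̄^+ \ M_γ^+, then for all sufficiently small δ > 0 one has μ([x̄, x̄+δ]) = 0 and ν([x̄+λ_C−δ, x̄+λ_C]) = 0. -/

import Mathlib

open MeasureTheory Set Filter Topology
open scoped ENNReal NNReal

noncomputable section

/-- Topological support of a measure: points all of whose open neighborhoods have
positive measure. -/
def mSupport {α : Type*} [TopologicalSpace α] [MeasurableSpace α] (γ : Measure α) : Set α :=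
  {x | ∀ U : Set α, IsOpen U → x ∈ U → 0 < γ U}

/-- γ is a transport plan (coupling) between μ and ν. -/
def IsCoupling {α : Type*} [MeasurableSpace α] (μ ν : Measure α) (γ : Measure (α × α)) : Prop :=
  γ.fst = μ ∧ γ.snd = ν

/-- The γ-essential supremum of the distance |x - y|. -/
def costInf {α : Type*} [MeasurableSpace α] [PseudoEMetricSpace α]
    (γ : Measure (α × α)) : ℝ≥0∞ :=
  essSup (fun p => edist p.1 p.2) γ

/-- The L^∞ optimal transport cost W∞(μ, ν). -/
def Winfty {α : Type*} [MeasurableSpace α] [PseudoEMetricSpace α] (μ ν : Measure α) : ℝ≥0∞ :=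
  ⨅ (γ : Measure (α × α)) (_ : IsCoupling μ ν γ), costInf γ

/-- γ is an optimal plan for the L^∞ optimal transport problem. -/
def IsOptimalPlan {α : Type*} [MeasurableSpace α] [PseudoEMetricSpace α]
    (μ ν : Measure α) (γ : Measure (α × α)) : Prop :=
  IsCoupling μ ν γ ∧ costInf γ = Winfty μ ν

/-- μ is compactly supported. -/
def CompactlySupported {α : Type*} [TopologicalSpace α] [MeasurableSpace α]
    (μ : Measure α) : Prop :=
  ∃ K : Set α, IsCompact K ∧ μ Kᶜ = 0

/-- The admissible class U_λ of the dual problem. -/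
def DualAdm {α : Type*} [MeasurableSpace α] [PseudoMetricSpace α]
    (μ ν : Measure α) (lam : ℝ) (φ ψ : α → ℝ) : Prop :=
  Integrable φ μ ∧ Integrable ψ ν ∧
    ∀ᵐ x ∂μ, ∀ᵐ y ∂ν, dist x y ≤ lam → φ x + ψ y ≤ 0

/-- ∞-cyclical monotonicity of a plan on ℝ. -/
def InfCM (γ : Measure (ℝ × ℝ)) : Prop :=
  ∀ (n : ℕ) (p : Fin (n + 1) → ℝ × ℝ), (∀ i, p i ∈ mSupport γ) →
    (⨆ i, |(p i).1 - (p i).2|) ≤ ⨆ i, |(p i).1 - (p (i + 1)).2|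

/-- Points moved at maximal distance to the right. -/
def Mplus (γ : Measure (ℝ × ℝ)) (lam : ℝ) : Set ℝ := {x | (x, x + lam) ∈ mSupport γ}

/-- Points moved at maximal distance to the left. -/
def Mminus (γ : Measure (ℝ × ℝ)) (lam : ℝ) : Set ℝ := {x | (x, x - lam) ∈ mSupport γ}


lemma ae_mem_mSupport (γ : Measure (ℝ × ℝ)) : ∀ᵐ p ∂γ, p ∈ mSupport γ := by
  filter_upwards [Measure.support_mem_ae (μ := γ)] with p hp U hU hpU
  exact (Measure.mem_support_iff_forall p).1 hp U (hU.mem_nhds hpU)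

namespace IsCoupling

variable {μ ν : Measure ℝ} {γ : Measure (ℝ × ℝ)}

lemma measure_fst_preimage (h : IsCoupling μ ν γ) {s : Set ℝ} (hs : MeasurableSet s) :
    γ {p | p.1 ∈ s} = μ s := by
  rw [← h.1, Measure.fst_apply hs]; rfl

lemma measure_snd_preimage (h : IsCoupling μ ν γ) {s : Set ℝ} (hs : MeasurableSet s) :
    γ {p | p.2 ∈ s} = ν s := by
  rw [← h.2, Measure.snd_apply hs]; rfl

lemma isProbabilityMeasure [IsProbabilityMeasure μ] (h : IsCoupling μ ν γ) :
    IsProbabilityMeasure γ :=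
  ⟨by simpa using h.measure_fst_preimage MeasurableSet.univ⟩

lemma costInf_lt_top (hμ : CompactlySupported μ) (hν : CompactlySupported ν)
    (h : IsCoupling μ ν γ) : costInf γ < ⊤ := by
  obtain ⟨K, hK, hμK⟩ := hμ
  obtain ⟨L, hL, hνL⟩ := hν
  have h1 : ∀ᵐ p ∂γ, p.1 ∈ K := by
    have := h.measure_fst_preimage hK.measurableSet.compl
    rwa [hμK] at this
  have h2 : ∀ᵐ p ∂γ, p.2 ∈ L := by
    have := h.measure_snd_preimage hL.measurableSet.compl
    rwa [hνL] at this
  refine lt_of_le_of_lt (essSup_le_of_ae_le (Metric.ediam (K ∪ L)) ?_)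
    (hK.union hL).isBounded.ediam_ne_top.lt_top
  filter_upwards [h1, h2] with p hp1 hp2
  exact Metric.edist_le_ediam_of_mem (Or.inl hp1) (Or.inr hp2)

end IsCoupling

lemma IsOptimalPlan.ae_abs_sub_le {μ ν : Measure ℝ} {γ : Measure (ℝ × ℝ)}
    (hμ : CompactlySupported μ) (hν : CompactlySupported ν) (h : IsOptimalPlan μ ν γ) :
    ∀ᵐ p ∂γ, |p.1 - p.2| ≤ (Winfty μ ν).toReal := by
  have htop : costInf γ < ⊤ := h.1.costInf_lt_top hμ hν
  filter_upwards [ae_le_essSup (f := fun p : ℝ × ℝ => edist p.1 p.2) (μ := γ)] with p hp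
  rw [← h.2, ← Real.dist_eq, dist_edist]
  exact ENNReal.toReal_mono htop.ne hp

lemma InfCM.max_abs_sub_le {γ : Measure (ℝ × ℝ)} (h : InfCM γ) {p q : ℝ × ℝ}
    (hp : p ∈ mSupport γ) (hq : q ∈ mSupport γ) :
    max |p.1 - p.2| |q.1 - q.2| ≤ max |p.1 - q.2| |q.1 - p.2| := by
  have key := h 1 ![p, q] (by intro i; fin_cases i <;> simpa)
  refine (max_le ?_ ?_).trans (key.trans (ciSup_le ?_))
  · exact le_ciSup (f := fun i => |(![p, q] i).1 - (![p, q] i).2|) (Set.finite_range _).bddAbove 0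
  · exact le_ciSup (f := fun i => |(![p, q] i).1 - (![p, q] i).2|) (Set.finite_range _).bddAbove 1
  · intro i
    fin_cases i <;> simp

/-- In an `∞`-cyclically monotone plan of cost at most `lam`, a point moved to the right by `lam`
is never overtaken. -/
lemma InfCM.ae_le_snd_of_lt_fst {γ : Measure (ℝ × ℝ)} (h : InfCM γ) {lam x₀ : ℝ}
    (hle : ∀ᵐ p ∂γ, |p.1 - p.2| ≤ lam) (hx₀ : x₀ ∈ Mplus γ lam) :
    ∀ᵐ p ∂γ, x₀ < p.1 → x₀ + lam ≤ p.2 := by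
  filter_upwards [hle, ae_mem_mSupport γ] with p hp hps hlt
  by_contra! hlt'
  have hcyc := (le_max_left _ _).trans (h.max_abs_sub_le hx₀ hps)
  rw [abs_le] at hp
  have h1 : |x₀ - p.2| < lam := abs_lt.2 ⟨by linarith, by linarith⟩
  have h2 : |p.1 - (x₀ + lam)| < lam := abs_lt.2 ⟨by linarith, by linarith⟩
  have h3 : lam ≤ |x₀ - (x₀ + lam)| := by
    rw [sub_add_cancel_left, abs_neg]
    exact le_abs_self lam
  exact absurd (h3.trans hcyc) (not_le.2 (max_lt h1 h2))

/-- If some plan of cost at most `lam` splits the mass at `(x₀, x₀ + lam)`, then so does every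
other. -/
lemma IsCoupling.ae_fst_le_iff_snd_le {μ ν : Measure ℝ} [IsProbabilityMeasure μ]
    [NullSingletonClass ν] {γ γ' : Measure (ℝ × ℝ)} (hγ : IsCoupling μ ν γ)
    (hγ' : IsCoupling μ ν γ') {lam x₀ : ℝ} (hle : ∀ᵐ p ∂γ, |p.1 - p.2| ≤ lam)
    (hsplit : ∀ᵐ p ∂γ', x₀ < p.1 → x₀ + lam ≤ p.2) :
    ∀ᵐ p ∂γ, p.1 ≤ x₀ ↔ p.2 ≤ x₀ + lam := by
  have := hγ.isProbabilityMeasure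
  have hmass : ν (Iic (x₀ + lam)) ≤ μ (Iic x₀) := by
    rw [← measure_congr (Iio_ae_eq_Iic (μ := ν)), ← hγ'.measure_snd_preimage measurableSet_Iio,
      ← hγ'.measure_fst_preimage measurableSet_Iic]
    refine measure_mono_ae ?_
    filter_upwards [hsplit] with p hp hp2
    exact not_lt.1 fun hlt => (hp hlt).not_gt hp2
  have heq : {p : ℝ × ℝ | p.1 ∈ Iic x₀} =ᵐ[γ] {p | p.2 ∈ Iic (x₀ + lam)} := by
    refine ae_eq_of_ae_subset_of_measure_ge ?_ ?_
      (measurable_fst measurableSet_Iic).nullMeasurableSet (measure_ne_top _ _)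
    · filter_upwards [hle] with p hp (hp1 : p.1 ≤ x₀)
      change p.2 ≤ x₀ + lam
      linarith [(abs_le.1 hp).1]
    · rwa [hγ.measure_fst_preimage measurableSet_Iic, hγ.measure_snd_preimage measurableSet_Iic]
  filter_upwards [heq] with p hp using iff_of_eq hp

/-- If x̄ ∈ M_γ̄⁺ \ M_γ⁺ for some optimal plan γ, then for all small enough δ > 0,
μ([x̄, x̄+δ]) = 0 and ν([x̄+λ_C−δ, x̄+λ_C]) = 0. -/
theorem mu_nu_null_near_missing_point (μ ν : Measure ℝ)
    [IsProbabilityMeasure μ] [IsProbabilityMeasure ν] [NullSingletonClass μ] [NullSingletonClass ν]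
    (hμ : CompactlySupported μ) (hν : CompactlySupported ν)
    (γ γbar : Measure (ℝ × ℝ)) (hγ : IsOptimalPlan μ ν γ)
    (hγbar : IsOptimalPlan μ ν γbar) (hcm : InfCM γbar)
    (x₀ : ℝ) (hx₀ : x₀ ∈ Mplus γbar (Winfty μ ν).toReal)
    (hx₀' : x₀ ∉ Mplus γ (Winfty μ ν).toReal) :
    ∃ δ₀ > 0, ∀ δ : ℝ, 0 < δ → δ ≤ δ₀ →
      μ (Set.Icc x₀ (x₀ + δ)) = 0 ∧
      ν (Set.Icc (x₀ + (Winfty μ ν).toReal - δ) (x₀ + (Winfty μ ν).toReal)) = 0 := by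
  set lam := (Winfty μ ν).toReal
  have hle := hγ.ae_abs_sub_le hμ hν
  have hiff := hγ.1.ae_fst_le_iff_snd_le hγbar.1 hle
    (hcm.ae_le_snd_of_lt_fst (hγbar.ae_abs_sub_le hμ hν) hx₀)
  have hx₁ : (x₀, x₀ + lam) ∉ mSupport γ := hx₀'
  simp only [mSupport, mem_ofPred_eq, not_forall, not_lt, nonpos_iff_eq_zero] at hx₁
  obtain ⟨U, hU, hmem, hU0⟩ := hx₁
  obtain ⟨ε, hε, hball⟩ := Metric.isOpen_iff.1 hU _ hmem
  have hfar : ∀ᵐ p ∂γ, ¬ (|p.1 - x₀| < ε ∧ |p.2 - (x₀ + lam)| < ε) := by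
    filter_upwards [measure_eq_zero_iff_ae_notMem.1 hU0] with p hp hnear
    refine hp (hball ?_)
    rw [Metric.mem_ball, Prod.dist_eq]
    exact max_lt hnear.1 hnear.2
  refine ⟨ε / 2, half_pos hε, fun δ _ hδε => ⟨?_, ?_⟩⟩
  · rw [← measure_congr (Ioc_ae_eq_Icc (μ := μ)), ← hγ.1.measure_fst_preimage measurableSet_Ioc]
    refine measure_eq_zero_iff_ae_notMem.2 ?_
    filter_upwards [hle, hiff, hfar] with p hp hpiff hpfar hmem
    have h1 : x₀ < p.1 := hmem.1
    have h2 : p.1 ≤ x₀ + δ := hmem.2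
    have h3 : x₀ + lam < p.2 := not_le.1 fun h => (hpiff.2 h).not_gt h1
    have h4 := (abs_le.1 hp).1
    exact hpfar ⟨abs_lt.2 ⟨by linarith, by linarith⟩, abs_lt.2 ⟨by linarith, by linarith⟩⟩
  · rw [← hγ.1.measure_snd_preimage measurableSet_Icc]
    refine measure_eq_zero_iff_ae_notMem.2 ?_
    filter_upwards [hle, hiff, hfar] with p hp hpiff hpfar hmem
    have h1 : x₀ + lam - δ ≤ p.2 := hmem.1
    have h2 : p.2 ≤ x₀ + lam := hmem.2
    have h3 : p.1 ≤ x₀ := hpiff.2 h2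
    have h4 := (abs_le.1 hp).1
    exact hpfar ⟨abs_lt.2 ⟨by linarith, by linarith⟩, abs_lt.2 ⟨by linarith, by linarith⟩⟩

end
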